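/- arXiv:1905.11511 — 2 statements merged into one kernel-verified Lean document; each statement's English description precedes it below -/
import Mathlib

section
/- Let q > 0, q ≠ 1 be real, and let s ∈ ℂ with s ≠ 0 and D(s) ≠ 0. Then the complex-valued function x(ξ,t) := G(ξ,s)·e^{st} of the real variables (ξ,t) satisfies the wave equation ∂²x/∂t²(ξ,t) = ∂²x/∂ξ²(ξ,t) for all ξ ∈ [0,1] and t ∈ ℝ, together with the boundary conditions ∂x/∂ξ(0,t) = −q·∂x/∂t(0,t) and ∂x/∂ξ(1,t) = e^{st} for all t ∈ ℝ. -/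
open Complex

/-- `D q s = (1-q)e^s - (1+q)e^{-s}`. -/
noncomputable def D (q : ℝ) (s : ℂ) : ℂ :=
  (1 - (q : ℂ)) * Complex.exp s - (1 + (q : ℂ)) * Complex.exp (-s)

/-- The transfer function `G(ξ,s) = (1/s)·((1-q)e^{sξ} + (1+q)e^{-sξ})/D(s)`,
as a function of the real variable `ξ`. -/
noncomputable def G (q : ℝ) (s : ℂ) (ξ : ℝ) : ℂ :=
  (1 / s) * (((1 - (q : ℂ)) * Complex.exp (s * ξ)
    + (1 + (q : ℂ)) * Complex.exp (-(s * ξ))) / D q s)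

/-- `x(ξ,t) = G(ξ,s)·e^{st}`. -/
noncomputable def x (q : ℝ) (s : ℂ) (ξ t : ℝ) : ℂ :=
  G q s ξ * Complex.exp (s * t)

lemma hasDerivAt_exp_aux (c : ℂ) (r : ℝ) :
    HasDerivAt (fun r : ℝ => Complex.exp (c * r)) (c * Complex.exp (c * r)) r := by
  have h : HasDerivAt (fun z : ℂ => Complex.exp (c * z)) (Complex.exp (c * r) * (c * 1)) (r : ℂ) :=
    ((hasDerivAt_id (r : ℂ)).const_mul c).cexp
  have h2 := h.comp_ofReal
  convert h2 using 1
  ring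

/-- First derivative of a combination of two exponentials. -/
lemma deriv_comb_aux (a b c : ℂ) :
    deriv (fun r : ℝ => a * Complex.exp (c * r) + b * Complex.exp (-c * r))
      = fun r : ℝ => (a * c) * Complex.exp (c * r) + (b * -c) * Complex.exp (-c * r) := by
  funext r
  have h := ((hasDerivAt_exp_aux c r).const_mul a).add ((hasDerivAt_exp_aux (-c) r).const_mul b)
  refine h.deriv.trans ?_
  ring

lemma x_space_aux (q : ℝ) (s : ℂ) (t : ℝ) : (fun ξ : ℝ => x q s ξ t)
    = fun r : ℝ => ((1 / s) * (1 - (q : ℂ)) / D q s * Complex.exp (s * t)) * Complex.exp (s * r)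
      + ((1 / s) * (1 + (q : ℂ)) / D q s * Complex.exp (s * t)) * Complex.exp (-s * r) := by
  funext r
  simp only [x, G, neg_mul]
  ring

lemma x_time_aux (q : ℝ) (s : ℂ) (ξ : ℝ) : (fun t : ℝ => x q s ξ t)
    = fun r : ℝ => G q s ξ * Complex.exp (s * r) + 0 * Complex.exp (-s * r) := by
  funext r
  simp only [x]
  ring

theorem stmt_0 (q : ℝ) (hq : 0 < q) (hq1 : q ≠ 1) (s : ℂ) (hs : s ≠ 0)
    (hD : D q s ≠ 0) :
    (∀ ξ ∈ Set.Icc (0 : ℝ) 1, ∀ t : ℝ,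
      iteratedDeriv 2 (fun t' : ℝ => x q s ξ t') t
        = iteratedDeriv 2 (fun ξ' : ℝ => x q s ξ' t) ξ) ∧
    (∀ t : ℝ,
      deriv (fun ξ' : ℝ => x q s ξ' t) 0
        = -(q : ℂ) * deriv (fun t' : ℝ => x q s 0 t') t) ∧
    (∀ t : ℝ, deriv (fun ξ' : ℝ => x q s ξ' t) 1 = Complex.exp (s * t)) := by
  refine ⟨fun ξ _ t => ?_, fun t => ?_, fun t => ?_⟩
  · rw [x_space_aux, x_time_aux, iteratedDeriv_succ, iteratedDeriv_one, deriv_comb_aux,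
      deriv_comb_aux, iteratedDeriv_succ, iteratedDeriv_one, deriv_comb_aux, deriv_comb_aux]
    simp only [G, neg_mul]
    ring
  · rw [x_space_aux, x_time_aux, deriv_comb_aux, deriv_comb_aux]
    simp only [G, Complex.ofReal_zero, mul_zero, neg_zero, Complex.exp_zero]
    field_simp
    ring
  · rw [x_space_aux, deriv_comb_aux]
    simp only [Complex.ofReal_one, mul_one]
    have h : D q s = (1 - (q : ℂ)) * Complex.exp s - (1 + (q : ℂ)) * Complex.exp (-s) := rfl
    field_simp
    rw [h]
    ring
end

section
/- Let q > 0, q ≠ 1 be real, let Q := (1+q)/(1−q), and let s ∈ ℂ with s ≠ 0 and D(s) ≠ 0. Then G₂(s)/(1+G₃(s)) = (1+Q)/(2s) − Q(1−e^{−2s})/(2s), i.e. the second entry of Ĝ := G/(1+G₃) decomposes as the rational part (1+Q)/(2s) plus the stable infinite-dimensional part −Q(1−e^{−2s})/(2s). -/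
open Complex

theorem stmt_7 (q : ℝ) (hq : 0 < q) (hq1 : q ≠ 1) (s : ℂ) (hs : s ≠ 0)
    (hD : D q s ≠ 0) :
    G q s 1 / (1 + s * G q s 1)
      = (1 + (1 + (q : ℂ)) / (1 - (q : ℂ))) / (2 * s)
        - ((1 + (q : ℂ)) / (1 - (q : ℂ))) * (1 - Complex.exp (-(2 * s))) / (2 * s) := by
  have h1 : (1 - (q : ℂ)) ≠ 0 := by
    intro h
    apply hq1
    have h2 : (q : ℂ) = 1 := (sub_eq_zero.mp h).symm
    exact_mod_cast h2
  have he : Complex.exp s ≠ 0 := Complex.exp_ne_zero s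
  have he2 : Complex.exp (-(2 * s)) = (Complex.exp s)⁻¹ * (Complex.exp s)⁻¹ := by
    rw [← Complex.exp_neg, ← Complex.exp_add]
    congr 1
    ring
  have hG : s * G q s 1 = ((1 - (q : ℂ)) * Complex.exp s
      + (1 + (q : ℂ)) * Complex.exp (-s)) / D q s := by
    simp only [G, Complex.ofReal_one, mul_one]
    rw [← mul_assoc, mul_one_div_cancel hs, one_mul]
  have hden : 1 + s * G q s 1 = 2 * ((1 - (q : ℂ)) * Complex.exp s) / D q s := by
    rw [hG, eq_div_iff hD, add_mul, div_mul_cancel₀ _ hD, D]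
    ring
  have hG' : G q s 1 = ((1 - (q : ℂ)) * Complex.exp s
      + (1 + (q : ℂ)) * Complex.exp (-s)) / D q s / s := by
    rw [← hG, mul_div_cancel_left₀ _ hs]
  rw [hden, hG', he2, Complex.exp_neg]
  field_simp
  ring
end
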